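/- Let H be a real Hilbert space, φ : ℝ^d → H continuously differentiable with kernel k(x,y) = ⟨φ(x), φ(y)⟩_H, and let p, q be strictly positive continuously differentiable probability densities on ℝ^d. Define ξ_p(x) ∈ H^d with components ξ_{p,i}(x) = (∂ log p(x)/∂x_i) φ(x) + ∂φ(x)/∂x_i, and ξ_q analogously; let q also denote the measure q(x)dx. Assume: (i) ∫ ⟨ξ_q(z), ξ_q(z)⟩_{H^d} dq(z) < ∞ and ∫ ξ_q dq = 0; (ii) ∫ ‖∇ log(p(z)/q(z))‖² dq(z) < ∞; (iii) ξ_p is Bochner integrable with respect to q; (iv) the kernel embedding is injective on square-integrable functions, i.e., for every measurable g : ℝ^d → ℝ with ∫ g(z)² dq(z) < ∞, if ∫ g(z) φ(z) dq(z) = 0 in H then g = 0 q-almost everywhere. Then ∫ ξ_p(z) dq(z) = 0 in H^d if and only if p = q. -/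

import Mathlib

open MeasureTheory Filter
open scoped RealInnerProductSpace BigOperators

/-- The `i`-th partial derivative of `log r` at `x`. -/
noncomputable def dlog {d : ℕ} (r : (Fin d → ℝ) → ℝ) (x : Fin d → ℝ) (i : Fin d) : ℝ :=
  fderiv ℝ (fun y => Real.log (r y)) x (Pi.single i 1)

/-- The Stein feature `ξ_r(x) ∈ H^d` with `i`-th component
`ξ_{r,i}(x) = (∂ log r(x)/∂xᵢ) φ(x) + ∂φ(x)/∂xᵢ`. -/
noncomputable def steinXi {d : ℕ} {H : Type*} [NormedAddCommGroup H]
    [InnerProductSpace ℝ H] (φ : (Fin d → ℝ) → H) (r : (Fin d → ℝ) → ℝ)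
    (x : Fin d → ℝ) : PiLp 2 (fun _ : Fin d => H) :=
  (WithLp.equiv 2 (∀ _ : Fin d, H)).symm fun i =>
    dlog r x i • φ x + fderiv ℝ φ x (Pi.single i 1)

section SteinAux

variable {d : ℕ} {H : Type*} [NormedAddCommGroup H] [InnerProductSpace ℝ H]

lemma contDiff_log_of_pos {r : (Fin d → ℝ) → ℝ} (hr : ContDiff ℝ 1 r) (hpos : ∀ x, 0 < r x) :
    ContDiff ℝ 1 (fun y => Real.log (r y)) :=
  hr.log fun x => (hpos x).ne'

lemma continuous_dlog {r : (Fin d → ℝ) → ℝ} (hr : ContDiff ℝ 1 r) (hpos : ∀ x, 0 < r x)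
    (i : Fin d) : Continuous fun x => dlog r x i :=
  ((contDiff_log_of_pos hr hpos).continuous_fderiv one_ne_zero).clm_apply continuous_const

lemma continuous_steinXi {φ : (Fin d → ℝ) → H} (hφ : ContDiff ℝ 1 φ) {r : (Fin d → ℝ) → ℝ}
    (hr : ContDiff ℝ 1 r) (hpos : ∀ x, 0 < r x) : Continuous (steinXi φ r) := by
  refine (PiLp.continuous_toLp 2 _).comp (continuous_pi fun i => ?_)
  exact ((continuous_dlog hr hpos i).smul hφ.continuous).add
    ((hφ.continuous_fderiv one_ne_zero).clm_apply continuous_const)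

lemma steinXi_sub_apply (φ : (Fin d → ℝ) → H) (p q : (Fin d → ℝ) → ℝ) (x : Fin d → ℝ)
    (i : Fin d) :
    (steinXi φ p x - steinXi φ q x) i = (dlog p x i - dlog q x i) • φ x := by
  simp [steinXi, sub_smul]

/-- Two probability densities whose logarithms have the same gradient are equal. -/
lemma eq_of_dlog_eq {p q : (Fin d → ℝ) → ℝ}
    (hp_pos : ∀ x, 0 < p x) (hp_smooth : ContDiff ℝ 1 p) (hp_dens : ∫ x, p x = 1)
    (hq_pos : ∀ x, 0 < q x) (hq_smooth : ContDiff ℝ 1 q) (hq_dens : ∫ x, q x = 1)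
    (h : ∀ x i, dlog p x i = dlog q x i) : p = q := by
  have hlp := (contDiff_log_of_pos hp_smooth hp_pos).differentiable one_ne_zero
  have hlq := (contDiff_log_of_pos hq_smooth hq_pos).differentiable one_ne_zero
  have hconst : ∀ x y, Real.log (p x) - Real.log (q x) = Real.log (p y) - Real.log (q y) := by
    refine is_const_of_fderiv_eq_zero (hlp.sub hlq) fun x => ?_
    have hfd : fderiv ℝ (fun y => Real.log (p y)) x = fderiv ℝ (fun y => Real.log (q y)) x := by
      apply ContinuousLinearMap.coe_injective
      exact LinearMap.pi_ext' fun i => LinearMap.ext_ring (h x i)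
    rw [fderiv_fun_sub (hlp x) (hlq x), hfd, sub_self]
  have hmul : ∀ x, p x = p 0 / q 0 * q x := by
    intro x
    have hx := congrArg Real.exp (hconst x 0)
    rw [Real.exp_sub, Real.exp_sub, Real.exp_log (hp_pos _), Real.exp_log (hq_pos _),
      Real.exp_log (hp_pos _), Real.exp_log (hq_pos _)] at hx
    rw [← hx, div_mul_cancel₀ _ (hq_pos x).ne']
  have hone : p 0 / q 0 = 1 := by
    rw [← hp_dens, integral_congr_ae (ae_of_all _ hmul), integral_const_mul, hq_dens, mul_one]
  funext x
  rw [hmul x, hone, one_mul]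

lemma isOpenPosMeasure_withDensity_ofReal {q : (Fin d → ℝ) → ℝ} (hq : Continuous q)
    (hq_pos : ∀ x, 0 < q x) :
    (volume.withDensity fun x => ENNReal.ofReal (q x)).IsOpenPosMeasure :=
  (withDensity_absolutelyContinuous' hq.measurable.ennreal_ofReal.aemeasurable
    (ae_of_all _ fun x => (ENNReal.ofReal_pos.2 (hq_pos x)).ne')).isOpenPosMeasure

end SteinAux

/-- Theorem 2 of the paper: under the stated integrability conditions and
injectivity of the kernel mean embedding on square-integrable functions, the Stein
discrepancy vanishes, i.e. `∫ ξ_p dq = 0` in `H^d` (where `dq = q(x)dx`), if and only if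
`p = q`. -/
theorem stein_discrepancy_zero_iff_eq {d : ℕ} {H : Type*} [NormedAddCommGroup H]
    [InnerProductSpace ℝ H] [CompleteSpace H]
    (φ : (Fin d → ℝ) → H) (hφ : ContDiff ℝ 1 φ)
    (p q : (Fin d → ℝ) → ℝ)
    (hp_pos : ∀ x, 0 < p x) (hp_smooth : ContDiff ℝ 1 p) (hp_dens : ∫ x, p x = 1)
    (hq_pos : ∀ x, 0 < q x) (hq_smooth : ContDiff ℝ 1 q) (hq_dens : ∫ x, q x = 1)
    -- (i) finite second moment of ξ_q under q, and ∫ ξ_q dq = 0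
    (hq_sq : Integrable (fun z => ⟪steinXi φ q z, steinXi φ q z⟫)
      (volume.withDensity fun x => ENNReal.ofReal (q x)))
    (hq_zero :
      ∫ z, steinXi φ q z ∂(volume.withDensity fun x => ENNReal.ofReal (q x)) = 0)
    -- (ii) square integrability of ∇ log (p/q) under q
    (hgrad_sq : Integrable (fun z => ∑ i, (dlog p z i - dlog q z i) ^ 2)
      (volume.withDensity fun x => ENNReal.ofReal (q x)))
    -- (iii) Bochner integrability of ξ_p under q
    (hintp : Integrable (steinXi φ p) (volume.withDensity fun x => ENNReal.ofReal (q x)))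
    -- (iv) injectivity of the kernel mean embedding on square-integrable functions
    (hembed : ∀ g : (Fin d → ℝ) → ℝ, Measurable g →
      Integrable (fun z => g z ^ 2) (volume.withDensity fun x => ENNReal.ofReal (q x)) →
      (∫ z, g z • φ z ∂(volume.withDensity fun x => ENNReal.ofReal (q x)) = 0) →
      g =ᵐ[volume.withDensity fun x => ENNReal.ofReal (q x)] 0) :
    (∫ z, steinXi φ p z ∂(volume.withDensity fun x => ENNReal.ofReal (q x)) = 0)
      ↔ p = q := by
  set μ := volume.withDensity fun x => ENNReal.ofReal (q x)
  refine ⟨fun hp_zero => ?_, fun hpq => hpq ▸ hq_zero⟩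
  have hq_int : Integrable q := by
    by_contra hnot
    simp [integral_undef hnot] at hq_dens
  have : IsFiniteMeasure μ := isFiniteMeasure_withDensity_ofReal hq_int.2
  have : μ.IsOpenPosMeasure := isOpenPosMeasure_withDensity_ofReal hq_smooth.continuous hq_pos
  have hcont := continuous_steinXi hφ hq_smooth hq_pos
  have hintq : Integrable (steinXi φ q) μ := by
    refine MemLp.integrable (q := 2) one_le_two ?_
    rw [memLp_two_iff_integrable_sq_norm hcont.aestronglyMeasurable]
    simpa only [real_inner_self_eq_norm_sq] using hq_sq
  have hsub : ∫ z, (steinXi φ p z - steinXi φ q z) ∂μ = 0 := by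
    rw [integral_sub hintp hintq, hp_zero, hq_zero, sub_zero]
  have hdiff_cont : ∀ i, Continuous fun z => dlog p z i - dlog q z i := fun i =>
    (continuous_dlog hp_smooth hp_pos i).sub (continuous_dlog hq_smooth hq_pos i)
  refine eq_of_dlog_eq hp_pos hp_smooth hp_dens hq_pos hq_smooth hq_dens fun x i => ?_
  have hsq : Integrable (fun z => (dlog p z i - dlog q z i) ^ 2) μ := by
    refine hgrad_sq.mono' ((hdiff_cont i).pow 2).aestronglyMeasurable (ae_of_all _ fun z => ?_)
    rw [Real.norm_of_nonneg (sq_nonneg _)]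
    exact Finset.single_le_sum (f := fun j => (dlog p z j - dlog q z j) ^ 2)
      (fun j _ => sq_nonneg _) (Finset.mem_univ i)
  have hembed_zero : ∫ z, (dlog p z i - dlog q z i) • φ z ∂μ = 0 := by
    have hproj := (PiLp.proj (𝕜 := ℝ) 2 (fun _ : Fin d => H) i).integral_comp_comm
      (hintp.sub hintq)
    simp only [Pi.sub_apply, hsub, map_zero, PiLp.proj_apply, steinXi_sub_apply] at hproj
    exact hproj
  have hae := hembed _ (hdiff_cont i).measurable hsq hembed_zero
  have hzero := (hdiff_cont i).ae_eq_iff_eq μ continuous_zero |>.1 hae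
  exact sub_eq_zero.1 (congrFun hzero x)
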